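/- If any one of the rules (l̄s), (w̄), (cl), (cr) is applied to a labeled polytree sequent (to labeled polytree premises), then its conclusion is a labeled polytree sequent. -/

import Mathlib

set_option linter.unusedVariables false

/-- Formulae of the tense language `L`. -/
inductive Fm : Type where
  | atom : Nat → Fm
  | top : Fm
  | bot : Fm
  | neg : Fm → Fm
  | or : Fm → Fm → Fm
  | and : Fm → Fm → Fm
  | imp : Fm → Fm → Fm
  | box : Fm → Fm
  | dia : Fm → Fm
  | boxP : Fm → Fm
  | diaP : Fm → Fm
deriving DecidableEq

instance : Inhabited Fm := ⟨Fm.top⟩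

/-- Labeled sequents `R, Γ ⇒ Δ`: a set of relational atoms together with multisets of
labeled formulae on the left and on the right. -/
structure LSeq : Type where
  rel : Finset (Nat × Nat)
  ant : Multiset (Nat × Fm)
  suc : Multiset (Nat × Fm)

/-- The empty labeled sequent. -/
def LSeq.empty : LSeq := ⟨∅, 0, 0⟩
instance : Inhabited LSeq := ⟨LSeq.empty⟩

/-- Sequent composition `⊗`. -/
def LSeq.comp (s t : LSeq) : LSeq := ⟨s.rel ∪ t.rel, s.ant + t.ant, s.suc + t.suc⟩

/-- The labeled sequent `w : A ⇒ ∅`. -/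
def Fq (w : Nat) (A : Fm) : LSeq := ⟨∅, {(w, A)}, 0⟩
/-- The labeled sequent `∅ ⇒ w : A`. -/
def Gq (w : Nat) (A : Fm) : LSeq := ⟨∅, 0, {(w, A)}⟩
/-- The labeled sequent `Rwu ⇒ ∅`. -/
def Rl (w u : Nat) : LSeq := ⟨{(w, u)}, 0, 0⟩

/-- The labels occurring in a labeled sequent. -/
def LSeq.labels (s : LSeq) : Finset Nat :=
  s.rel.image Prod.fst ∪ s.rel.image Prod.snd ∪
    (s.ant.map Prod.fst).toFinset ∪ (s.suc.map Prod.fst).toFinset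

/-- The length `|R| + |Γ| + |Δ|` of a labeled sequent. -/
def LSeq.len (s : LSeq) : Nat := s.rel.card + Multiset.card s.ant + Multiset.card s.suc

/-- Applying a label substitution to a labeled sequent. -/
def LSeq.rename (f : Nat → Nat) (s : LSeq) : LSeq :=
  ⟨s.rel.image (fun e => (f e.1, f e.2)),
   s.ant.map (fun x => (f x.1, x.2)),
   s.suc.map (fun x => (f x.1, x.2))⟩

/-- The (undirected simple) graph of a labeled sequent: labels as vertices, and an edge
between `a` and `b` for each relational atom `Rab`. -/
def LSeq.graph (s : LSeq) : SimpleGraph Nat :=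
  SimpleGraph.fromRel (fun a b => (a, b) ∈ s.rel)

/-- `s` is a labeled polytree sequent: (1) if `R = ∅` then `s` is `w`-flat for some `w`;
(2) if `R ≠ ∅` then every label of `Γ, Δ` occurs in `R`; (3) the graph of `s` is connected
and free of directed and undirected cycles. -/
def IsPolytree (s : LSeq) : Prop :=
  (s.rel = ∅ → ∃ w, (∀ x ∈ s.ant, x.1 = w) ∧ (∀ x ∈ s.suc, x.1 = w)) ∧
  (s.rel ≠ ∅ →
    (∀ x ∈ s.ant, x.1 ∈ s.rel.image Prod.fst ∪ s.rel.image Prod.snd) ∧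
    (∀ x ∈ s.suc, x.1 ∈ s.rel.image Prod.fst ∪ s.rel.image Prod.snd)) ∧
  (∀ a, (a, a) ∉ s.rel) ∧
  (∀ a b, (a, b) ∈ s.rel → (b, a) ∉ s.rel) ∧
  s.graph.IsAcyclic ∧
  (∀ a ∈ s.labels, ∀ b ∈ s.labels, s.graph.Reachable a b)

/-- Isomorphism of labeled sequents: a bijection between the label sets preserving and
reflecting relational atoms and labeled formulae on each side. -/
def LSeq.Iso (s t : LSeq) : Prop :=
  ∃ f : Nat → Nat, Set.BijOn f ↑s.labels ↑t.labels ∧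
    (∀ a b, (a, b) ∈ s.rel → (f a, f b) ∈ t.rel) ∧
    (∀ a b, a ∈ s.labels → b ∈ s.labels → (f a, f b) ∈ t.rel → (a, b) ∈ s.rel) ∧
    (∀ a A, (a, A) ∈ s.ant → (f a, A) ∈ t.ant) ∧
    (∀ a A, a ∈ s.labels → (f a, A) ∈ t.ant → (a, A) ∈ s.ant) ∧
    (∀ a A, (a, A) ∈ s.suc → (f a, A) ∈ t.suc) ∧
    (∀ a A, a ∈ s.labels → (f a, A) ∈ t.suc → (a, A) ∈ s.suc)

section Cuts

variable {α : Type*}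

theorem SimpleGraph.reachable_fromRel_iff (r : α → α → Prop) (a b : α) :
    (SimpleGraph.fromRel r).Reachable a b ↔
      ∀ f : α → Bool, (∀ x y, r x y → f x = f y) → f a = f b := by
  classical
  constructor
  · rintro ⟨p⟩ f hf
    induction p with
    | nil => rfl
    | cons h _ ih =>
      rw [← ih]
      rcases (SimpleGraph.fromRel_adj _ _ _).1 h with ⟨-, h | h⟩
      · exact hf _ _ h
      · exact (hf _ _ h).symm
  · intro h
    have hab := h (fun x => decide ((SimpleGraph.fromRel r).Reachable a x)) fun x y hxy => by
      by_cases hne : x = y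
      · rw [hne]
      · have hadj : (SimpleGraph.fromRel r).Adj x y :=
          (SimpleGraph.fromRel_adj _ _ _).2 ⟨hne, Or.inl hxy⟩
        exact decide_eq_decide.2
          ⟨fun h => h.trans hadj.reachable, fun h => h.trans hadj.symm.reachable⟩
    simpa using hab

/-- Every atom of `R` is the only one crossing some cut of the vertices. -/
def HasAtomCuts (R : Finset (α × α)) : Prop :=
  ∀ e ∈ R, ∃ f : α → Bool, f e.1 ≠ f e.2 ∧ ∀ d ∈ R, d ≠ e → f d.1 = f d.2

/-- No cut of the vertices which is crossed by no atom of `R` separates two elements of `S`. -/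
def NoEmptyCut (R : Finset (α × α)) (S : Finset α) : Prop :=
  ∀ f : α → Bool, (∀ d ∈ R, f d.1 = f d.2) → ∀ a ∈ S, ∀ b ∈ S, f a = f b

theorem hasAtomCuts_iff (R : Finset (α × α)) :
    HasAtomCuts R ↔ (∀ a, (a, a) ∉ R) ∧ (∀ a b, (a, b) ∈ R → (b, a) ∉ R) ∧
      (SimpleGraph.fromRel fun a b => (a, b) ∈ R).IsAcyclic := by
  have deleted (a b : α) (hba : (b, a) ∉ R) :
      (SimpleGraph.fromRel fun a b => (a, b) ∈ R).deleteEdges {s(a, b)} =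
        SimpleGraph.fromRel fun x y => (x, y) ∈ R ∧ (x, y) ≠ (a, b) := by
    ext x y
    simp only [SimpleGraph.deleteEdges_adj, SimpleGraph.fromRel_adj, Set.mem_singleton_iff,
      Sym2.eq_iff, ne_eq, Prod.mk.injEq]
    grind
  constructor
  · intro h
    have irrefl (a : α) : (a, a) ∉ R := fun ha => by
      obtain ⟨f, hf, -⟩ := h _ ha
      exact hf rfl
    have asymm (a b : α) (hab : (a, b) ∈ R) : (b, a) ∉ R := fun hba => by
      obtain ⟨f, hf, hf'⟩ := h _ hab
      refine hf (hf' _ hba fun heq => ?_).symm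
      obtain rfl : b = a := (Prod.mk.inj heq).1
      exact irrefl _ hab
    refine ⟨irrefl, asymm, SimpleGraph.isAcyclic_iff_forall_adj_isBridge.2 ?_⟩
    have bridge (a b : α) (hab : (a, b) ∈ R) :
        (SimpleGraph.fromRel fun a b => (a, b) ∈ R).IsBridge s(a, b) := by
      rw [SimpleGraph.isBridge_iff, deleted a b (asymm a b hab),
        SimpleGraph.reachable_fromRel_iff]
      intro hr
      obtain ⟨f, hf, hf'⟩ := h _ hab
      exact hf (hr f fun x y hxy => hf' _ hxy.1 hxy.2)
    intro a b hab
    rcases (SimpleGraph.fromRel_adj _ _ _).1 hab with ⟨-, h | h⟩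
    · exact bridge a b h
    · rw [Sym2.eq_swap]
      exact bridge b a h
  · rintro ⟨irrefl, asymm, hac⟩ ⟨a, b⟩ hab
    have hadj : (SimpleGraph.fromRel fun a b => (a, b) ∈ R).Adj a b :=
      (SimpleGraph.fromRel_adj _ _ _).2 ⟨fun h => irrefl b (h ▸ hab), Or.inl hab⟩
    have hbr := SimpleGraph.isAcyclic_iff_forall_adj_isBridge.1 hac hadj
    rw [SimpleGraph.isBridge_iff, deleted a b (asymm a b hab),
      SimpleGraph.reachable_fromRel_iff] at hbr
    push Not at hbr
    obtain ⟨f, hf, hne⟩ := hbr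
    exact ⟨f, hne, fun d hd hde => hf _ _ ⟨hd, hde⟩⟩

variable [DecidableEq α]

/-- Identifying `v` with `u` preserves atom cuts if it identifies two atoms `p` and `q`, such that
a cut crossed by both or by neither of them does not separate `u` from `v`. -/
theorem HasAtomCuts.image_identify {R : Finset (α × α)} (h : HasAtomCuts R) {u v : α}
    {p q : α × α} (hp : p ∈ R) (hq : q ∈ R) (hpq : p ≠ q)
    (himage : Prod.map (fun x => if x = v then u else x) (fun x => if x = v then u else x) p =
      Prod.map (fun x => if x = v then u else x) (fun x => if x = v then u else x) q)
    (hcut : ∀ f : α → Bool, (f p.1 = f p.2 ↔ f q.1 = f q.2) → f u = f v) :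
    HasAtomCuts (R.image fun e =>
      ((if e.1 = v then u else e.1 : α), (if e.2 = v then u else e.2 : α))) := by
  intro e' he'
  obtain ⟨e, he, rfl⟩ := Finset.mem_image.1 he'
  have factor (f : α → Bool) (huv : f u = f v) (x : α) : f (if x = v then u else x) = f x := by
    split_ifs with hx
    · rw [hx, huv]
    · rfl
  by_cases hepq : e = p ∨ e = q
  · obtain ⟨f, hf, hf'⟩ := h p hp
    obtain ⟨g, hg, hg'⟩ := h q hq
    have hfq := hf' q hq hpq.symm
    have hgp := hg' p hp hpq
    have hxp : (f p.1 ^^ g p.1) ≠ (f p.2 ^^ g p.2) := by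
      rw [hgp]
      simpa using hf
    have hxq : (f q.1 ^^ g q.1) ≠ (f q.2 ^^ g q.2) := by
      rw [hfq]
      simpa using hg
    have huv := hcut (fun x => f x ^^ g x) (iff_of_false hxp hxq)
    refine ⟨fun x => f x ^^ g x, ?_, ?_⟩
    · simp only [factor (fun x => f x ^^ g x) huv]
      rcases hepq with rfl | rfl
      · exact hxp
      · exact hxq
    · intro d' hd' hne
      obtain ⟨d, hd, rfl⟩ := Finset.mem_image.1 hd'
      simp only [factor (fun x => f x ^^ g x) huv]
      have hdp : d ≠ p := by
        rintro rfl
        rcases hepq with rfl | rfl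
        · exact hne rfl
        · exact hne himage
      have hdq : d ≠ q := by
        rintro rfl
        rcases hepq with rfl | rfl
        · exact hne himage.symm
        · exact hne rfl
      rw [hf' d hd hdp, hg' d hd hdq]
  · obtain ⟨hep, heq⟩ := not_or.1 hepq
    obtain ⟨f, hf, hf'⟩ := h e he
    have huv := hcut f (iff_of_true (hf' p hp (Ne.symm hep)) (hf' q hq (Ne.symm heq)))
    refine ⟨f, by simpa only [factor f huv] using hf, ?_⟩
    intro d' hd' hne
    obtain ⟨d, hd, rfl⟩ := Finset.mem_image.1 hd'
    simp only [factor f huv]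
    exact hf' d hd fun hde => hne (by rw [hde])

theorem NoEmptyCut.image {R : Finset (α × α)} {S : Finset α} (h : NoEmptyCut R S) (φ : α → α) :
    NoEmptyCut (R.image fun e => (φ e.1, φ e.2)) (S.image φ) := by
  intro f hf a' ha' b' hb'
  obtain ⟨a, ha, rfl⟩ := Finset.mem_image.1 ha'
  obtain ⟨b, hb, rfl⟩ := Finset.mem_image.1 hb'
  exact h (f ∘ φ) (fun d hd => hf _ (Finset.mem_image_of_mem _ hd)) a ha b hb

theorem NoEmptyCut.union {Q R : Finset (α × α)} {S T : Finset α} (hS : NoEmptyCut Q S)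
    (hT : NoEmptyCut R T) {x : α} (hxS : x ∈ S) (hxT : x ∈ T) :
    NoEmptyCut (Q ∪ R) (S ∪ T) := by
  intro f hf
  have key (a : α) (ha : a ∈ S ∪ T) : f a = f x := by
    rcases Finset.mem_union.1 ha with ha | ha
    · exact hS f (fun d hd => hf d (Finset.mem_union_left _ hd)) a ha x hxS
    · exact hT f (fun d hd => hf d (Finset.mem_union_right _ hd)) a ha x hxT
  intro a ha b hb
  rw [key a ha, key b hb]

theorem HasAtomCuts.union {Q R : Finset (α × α)} {S T : Finset α} (hQ : HasAtomCuts Q)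
    (hR : HasAtomCuts R) (hQS : ∀ d ∈ Q, d.1 ∈ S ∧ d.2 ∈ S) (hRT : ∀ d ∈ R, d.1 ∈ T ∧ d.2 ∈ T)
    {x : α} (hx : ∀ y ∈ S, y ∈ T → y = x) : HasAtomCuts (Q ∪ R) := by
  intro e he
  rcases Finset.mem_union.1 he with he | he
  · obtain ⟨f, hf, hf'⟩ := hQ e he
    have onS (y : α) (hy : y ∈ S) : (if y ∈ T then f x else f y) = f y := by
      split_ifs with hyT
      · rw [hx y hy hyT]
      · rfl
    refine ⟨fun y => if y ∈ T then f x else f y, ?_, ?_⟩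
    · simpa only [onS _ (hQS e he).1, onS _ (hQS e he).2] using hf
    · intro d hd hde
      rcases Finset.mem_union.1 hd with hd | hd
      · simpa only [onS _ (hQS d hd).1, onS _ (hQS d hd).2] using hf' d hd hde
      · simp only [(hRT d hd).1, (hRT d hd).2, if_true]
  · obtain ⟨f, hf, hf'⟩ := hR e he
    have onT (y : α) (hy : y ∈ T) : (if y ∈ S then f x else f y) = f y := by
      split_ifs with hyS
      · rw [hx y hyS hy]
      · rfl
    refine ⟨fun y => if y ∈ S then f x else f y, ?_, ?_⟩
    · simpa only [onT _ (hRT e he).1, onT _ (hRT e he).2] using hf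
    · intro d hd hde
      rcases Finset.mem_union.1 hd with hd | hd
      · simp only [(hQS d hd).1, (hQS d hd).2, if_true]
      · simpa only [onT _ (hRT d hd).1, onT _ (hRT d hd).2] using hf' d hd hde

end Cuts

namespace LSeq

theorem mem_labels {s : LSeq} {a : Nat} :
    a ∈ s.labels ↔ (∃ e ∈ s.rel, e.1 = a ∨ e.2 = a) ∨ (∃ x ∈ s.ant, x.1 = a) ∨
      ∃ x ∈ s.suc, x.1 = a := by
  simp only [labels, Finset.mem_union, Finset.mem_image, Multiset.mem_toFinset, Multiset.mem_map,
    and_or_left, exists_or, or_assoc]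

theorem rel_mem_labels {s : LSeq} {e : Nat × Nat} (he : e ∈ s.rel) :
    e.1 ∈ s.labels ∧ e.2 ∈ s.labels :=
  ⟨mem_labels.2 (.inl ⟨e, he, .inl rfl⟩), mem_labels.2 (.inl ⟨e, he, .inr rfl⟩)⟩

theorem labels_comp (s t : LSeq) : (s.comp t).labels = s.labels ∪ t.labels := by
  ext a
  simp only [Finset.mem_union, mem_labels, comp, Multiset.mem_add]
  grind

theorem labels_rename (f : Nat → Nat) (s : LSeq) :
    (s.rename f).labels = s.labels.image f := by
  ext a
  simp only [Finset.mem_image, mem_labels, rename, Multiset.mem_map]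
  grind

theorem empty_comp (s : LSeq) : empty.comp s = s := by
  simp [comp, empty]

theorem comp_empty (s : LSeq) : s.comp empty = s := by
  simp [comp, empty]

theorem rename_id (s : LSeq) : s.rename (fun x => x) = s := by
  simp [rename]

end LSeq

theorem isPolytree_iff (s : LSeq) :
    IsPolytree s ↔ NoEmptyCut s.rel s.labels ∧ HasAtomCuts s.rel := by
  have reach : (∀ a ∈ s.labels, ∀ b ∈ s.labels, s.graph.Reachable a b) ↔
      NoEmptyCut s.rel s.labels := by
    simp only [LSeq.graph, SimpleGraph.reachable_fromRel_iff, NoEmptyCut]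
    exact ⟨fun h f hf a ha b hb => h a ha b hb f fun x y hxy => hf _ hxy,
      fun h a ha b hb f hf => h f (fun d hd => hf _ _ hd) a ha b hb⟩
  rw [IsPolytree, reach, hasAtomCuts_iff]
  constructor
  · rintro ⟨-, -, h1, h2, h3, h4⟩
    exact ⟨h4, h1, h2, h3⟩
  · rintro ⟨h4, h1, h2, h3⟩
    refine ⟨fun hR => ?_, fun hR => ?_, h1, h2, h3, h4⟩
    · have hflat (a : Nat) (ha : a ∈ s.labels) (b : Nat) (hb : b ∈ s.labels) : a = b := by
        have := h4 (fun x => decide (x = b)) (by simp [hR]) a ha b hb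
        simpa using this
      have hw : ∃ w, ∀ a ∈ s.labels, a = w := by
        rcases s.labels.eq_empty_or_nonempty with h | ⟨w, hw⟩
        · exact ⟨0, by simp [h]⟩
        · exact ⟨w, fun a ha => hflat a ha w hw⟩
      obtain ⟨w, hw⟩ := hw
      exact ⟨w, fun x hx => hw _ (LSeq.mem_labels.2 (.inr (.inl ⟨x, hx, rfl⟩))),
        fun x hx => hw _ (LSeq.mem_labels.2 (.inr (.inr ⟨x, hx, rfl⟩)))⟩
    · obtain ⟨e, he⟩ := Finset.nonempty_iff_ne_empty.2 hR
      have key (a : Nat) (ha : a ∈ s.labels) :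
          a ∈ s.rel.image Prod.fst ∪ s.rel.image Prod.snd := by
        by_contra hna
        have hne (d : Nat × Nat) (hd : d ∈ s.rel) : d.1 ≠ a ∧ d.2 ≠ a :=
          ⟨fun h => hna (Finset.mem_union_left _ (Finset.mem_image.2 ⟨d, hd, h⟩)),
            fun h => hna (Finset.mem_union_right _ (Finset.mem_image.2 ⟨d, hd, h⟩))⟩
        have := h4 (fun x => decide (x = a)) (fun d hd => by simp [hne d hd]) a ha e.1
          (LSeq.rel_mem_labels he).1
        simp [hne e he] at this
      exact ⟨fun x hx => key _ (LSeq.mem_labels.2 (.inr (.inl ⟨x, hx, rfl⟩))),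
        fun x hx => key _ (LSeq.mem_labels.2 (.inr (.inr ⟨x, hx, rfl⟩)))⟩

namespace IsPolytree

theorem congr {s t : LSeq} (h : IsPolytree s) (hrel : s.rel = t.rel)
    (hlabels : s.labels = t.labels) : IsPolytree t := by
  rw [isPolytree_iff] at h ⊢
  rwa [← hrel, ← hlabels]

theorem rename_identify {s : LSeq} (h : IsPolytree s) {u v : Nat} {p q : Nat × Nat}
    (hp : p ∈ s.rel) (hq : q ∈ s.rel) (hpq : p ≠ q)
    (himage : Prod.map (fun x => if x = v then u else x) (fun x => if x = v then u else x) p =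
      Prod.map (fun x => if x = v then u else x) (fun x => if x = v then u else x) q)
    (hcut : ∀ f : Nat → Bool, (f p.1 = f p.2 ↔ f q.1 = f q.2) → f u = f v) :
    IsPolytree (s.rename fun x => if x = v then u else x) := by
  rw [isPolytree_iff] at h ⊢
  rw [LSeq.labels_rename]
  exact ⟨h.1.image fun x => if x = v then u else x, h.2.image_identify hp hq hpq himage hcut⟩

theorem comp {s t : LSeq} (hs : IsPolytree s) (ht : IsPolytree t)
    (hst : s ≠ LSeq.empty → t ≠ LSeq.empty → (s.labels ∩ t.labels).card = 1) :
    IsPolytree (s.comp t) := by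
  by_cases hs0 : s = LSeq.empty
  · rwa [hs0, LSeq.empty_comp]
  by_cases ht0 : t = LSeq.empty
  · rwa [ht0, LSeq.comp_empty]
  obtain ⟨x, hx⟩ := Finset.card_eq_one.1 (hst hs0 ht0)
  have hxst : x ∈ s.labels ∩ t.labels := by simp [hx]
  rw [isPolytree_iff] at hs ht ⊢
  rw [LSeq.labels_comp]
  refine ⟨hs.1.union ht.1 (Finset.mem_inter.1 hxst).1 (Finset.mem_inter.1 hxst).2,
    hs.2.union (x := x) ht.2 (fun _ => LSeq.rel_mem_labels) (fun _ => LSeq.rel_mem_labels)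
      fun y hys hyt => ?_⟩
  simpa [hx] using Finset.mem_inter.2 ⟨hys, hyt⟩

end IsPolytree

/-- Each of the rules `(l̄s)` (in both of its forms), `(w̄)`, `(cl)` and
`(cr)`, when applied to a labeled polytree sequent, yields a labeled polytree sequent. -/
theorem structural_rules_preserve_polytree :
    (∀ (z u v : Nat) (c : LSeq),
       IsPolytree ((Rl z u).comp ((Rl z v).comp c)) →
       IsPolytree (LSeq.rename (fun x => if x = v then u else x)
         ((Rl z u).comp ((Rl z v).comp c)))) ∧
    (∀ (z u v : Nat) (c : LSeq),
       IsPolytree ((Rl u z).comp ((Rl v z).comp c)) →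
       IsPolytree (LSeq.rename (fun x => if x = v then u else x)
         ((Rl u z).comp ((Rl v z).comp c)))) ∧
    (∀ (s t : LSeq), IsPolytree s → IsPolytree t →
       (s ≠ LSeq.empty → t ≠ LSeq.empty → (s.labels ∩ t.labels).card = 1) →
       IsPolytree (s.comp t)) ∧
    (∀ (w : Nat) (A : Fm) (c : LSeq),
       IsPolytree ((Fq w A).comp ((Fq w A).comp c)) → IsPolytree ((Fq w A).comp c)) ∧
    (∀ (w : Nat) (A : Fm) (c : LSeq),
       IsPolytree ((Gq w A).comp ((Gq w A).comp c)) → IsPolytree ((Gq w A).comp c)) := by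
  refine ⟨fun z u v c h => ?_, fun z u v c h => ?_, fun s t hs ht => hs.comp ht,
    fun w A c h => ?_, fun w A c h => ?_⟩
  · by_cases huv : u = v
    · subst huv
      convert h using 1
      convert LSeq.rename_id _ using 2
      grind
    · refine h.rename_identify (p := (z, u)) (q := (z, v)) ?_ ?_ ?_ ?_ ?_
      · simp [LSeq.comp, Rl]
      · simp [LSeq.comp, Rl]
      · simp [huv]
      · simp
      · intro f
        cases f z <;> cases f u <;> cases f v <;> simp
  · by_cases huv : u = v
    · subst huv
      convert h using 1
      convert LSeq.rename_id _ using 2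
      grind
    · refine h.rename_identify (p := (u, z)) (q := (v, z)) ?_ ?_ ?_ ?_ ?_
      · simp [LSeq.comp, Rl]
      · simp [LSeq.comp, Rl]
      · simp [huv]
      · simp
      · intro f
        cases f z <;> cases f u <;> cases f v <;> simp
  · exact h.congr (by simp [LSeq.comp, Fq]) (by simp [LSeq.labels_comp])
  · exact h.congr (by simp [LSeq.comp, Gq]) (by simp [LSeq.labels_comp])
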